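/- Consider Bernoulli site percolation on ℤ^d, d ≥ 2. For p < 1 sufficiently large there exist positive constants κ and c' such that for every c₁ ≥ c' the following holds P_p-almost surely for all sufficiently large n with c₁·log n ∈ ℕ and c₁·log n dividing n: if B_n = {1,…,n}^d is partitioned into cubes C_j, j ∈ J, of side length c₁·log n, then every open cluster M(n) of maximal cardinality in B_n satisfies #(M(n) ∩ C_j) ≥ κ·#C_j for all j ∈ J. -/

import Mathlib

open MeasureTheory Filter
open scoped ENNReal

noncomputable section

abbrev Site (d : ℕ) := Fin d → ℤ
abbrev PConfig (d : ℕ) := Site d → Bool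

/-- Bernoulli(p) site percolation measure on `ℤ^d`, characterized by its
cylinder probabilities. -/
def IsBernoulliPerc (d : ℕ) (p : ℝ) (μ : Measure (PConfig d)) : Prop :=
  IsProbabilityMeasure μ ∧
  ∀ (S : Finset (Site d)) (b : Site d → Bool),
    μ {ω | ∀ x ∈ S, ω x = b x} = ∏ x ∈ S, ENNReal.ofReal (if b x then p else 1 - p)

/-- the box `B_n = {1,…,n}^d`. -/
def percBox (d n : ℕ) : Set (Site d) := {x | ∀ i, 1 ≤ x i ∧ x i ≤ (n : ℤ)}

/-- nearest-neighbour adjacency on `ℤ^d` (Euclidean distance one). -/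
def percAdj {d : ℕ} (x y : Site d) : Prop := (∑ i, (x i - y i) ^ 2) = 1

/-- one step between open sites of the box. -/
def percStep (d n : ℕ) (ω : PConfig d) (x y : Site d) : Prop :=
  x ∈ percBox d n ∧ y ∈ percBox d n ∧ ω x = true ∧ ω y = true ∧ percAdj x y

/-- `C` is an open cluster of `B_n`: a nonempty, connected, maximal set of open sites. -/
def IsCluster (d n : ℕ) (ω : PConfig d) (C : Set (Site d)) : Prop :=
  C.Nonempty ∧ (∀ x ∈ C, x ∈ percBox d n ∧ ω x = true) ∧
  (∀ x ∈ C, ∀ y ∈ C, Relation.ReflTransGen (percStep d n ω) x y) ∧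
  (∀ x ∈ C, ∀ y, percStep d n ω x y → y ∈ C)

/-- `C` is an open cluster of maximal cardinality in `B_n`. -/
def IsMaxCluster (d n : ℕ) (ω : PConfig d) (C : Set (Site d)) : Prop :=
  IsCluster d n ω C ∧ ∀ C' : Set (Site d), IsCluster d n ω C' → C'.ncard ≤ C.ncard

/-- `ℓ^∞` distance on `ℤ^d`. -/
def linfD {d : ℕ} (x y : Site d) : ℕ := Finset.univ.sup fun i => (x i - y i).natAbs

/-- the (ℓ^∞) diameter of `C` is at least `⌊n/10⌋`. -/
def bigDiam (d n : ℕ) (C : Set (Site d)) : Prop := ∃ x ∈ C, ∃ y ∈ C, n / 10 ≤ linfD x y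

/-- event `𝒜_n`: at most one open cluster of diameter `≥ ⌊n/10⌋`. -/
def eventA (d n : ℕ) : Set (PConfig d) :=
  {ω | ∀ C C' : Set (Site d), IsCluster d n ω C → IsCluster d n ω C' →
    bigDiam d n C → bigDiam d n C' → C = C'}

/-- event `ℬ_n`: there is an open crossing cluster. -/
def eventB (d n : ℕ) : Set (PConfig d) :=
  {ω | ∃ C : Set (Site d), IsCluster d n ω C ∧
    ∀ j : Fin d, (∃ x ∈ C, x j = 1) ∧ (∃ x ∈ C, x j = (n : ℤ))}

/-- event `𝒞_n(κ)`: there is an open cluster with at least `κ n^d` points. -/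
def eventC (d n : ℕ) (κ : ℝ) : Set (PConfig d) :=
  {ω | ∃ C : Set (Site d), IsCluster d n ω C ∧ κ * (n : ℝ) ^ d ≤ (C.ncard : ℝ)}

/-- Nearest-neighbour adjacency on `ℤ^d` in terms of unit vectors. -/
def gridAdj {d : ℕ} (x y : Site d) : Prop :=
  ∃ i, y = x + Pi.single i 1 ∨ x = y + Pi.single i 1

/-- `ℓ^∞` adjacency on `ℤ^d`. -/
def starAdj {d : ℕ} (x y : Site d) : Prop := ∀ i, |x i - y i| ≤ 1

/-- A step of the relation `R` that stays inside `S`. -/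
def stepIn {α : Type*} (R : α → α → Prop) (S : Set α) (x y : α) : Prop :=
  x ∈ S ∧ y ∈ S ∧ R x y

/-- `S` is connected for the relation `R` using steps inside `S`. -/
def ConnIn {α : Type*} (R : α → α → Prop) (S : Set α) : Prop :=
  ∀ x ∈ S, ∀ y ∈ S, Relation.ReflTransGen (stepIn R S) x y

section Connectivity

variable {d : ℕ}

lemma gridAdj.symm {x y : Site d} (h : gridAdj x y) : gridAdj y x := by
  obtain ⟨i, h | h⟩ := h
  exacts [⟨i, Or.inr h⟩, ⟨i, Or.inl h⟩]

lemma starAdj.symm {x y : Site d} (h : starAdj x y) : starAdj y x := fun i => by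
  rw [abs_sub_comm]; exact h i

lemma gridAdj.percAdj {x y : Site d} (h : gridAdj x y) : percAdj x y := by
  unfold _root_.percAdj
  obtain ⟨i, rfl | rfl⟩ := h
  · simp [Pi.single_apply, ite_pow]
  · simp [Pi.single_apply, ite_pow]

lemma gridAdj.starAdj {x y : Site d} (h : gridAdj x y) : starAdj x y := by
  intro j
  obtain ⟨i, rfl | rfl⟩ := h <;>
  · by_cases hij : j = i <;> simp [hij]

lemma stepIn.mono {α : Type*} {R R' : α → α → Prop} {S S' : Set α} (hR : ∀ x y, R x y → R' x y)
    (hS : S ⊆ S') {x y : α} (h : Relation.ReflTransGen (stepIn R S) x y) :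
    Relation.ReflTransGen (stepIn R' S') x y :=
  Relation.ReflTransGen.mono (fun _ _ h => ⟨hS h.1, hS h.2.1, hR _ _ h.2.2⟩) _ _ h

lemma stepIn.reverse {α : Type*} {R : α → α → Prop} {S : Set α} (hR : ∀ x y, R x y → R y x)
    {x y : α} (h : Relation.ReflTransGen (stepIn R S) x y) :
    Relation.ReflTransGen (stepIn R S) y x := by
  induction h with
  | refl => exact .refl
  | tail _ h ih => exact ih.head ⟨h.2.1, h.1, hR _ _ h.2.2⟩

lemma stepIn.mem {α : Type*} {R : α → α → Prop} {S : Set α} {x y : α} (hx : x ∈ S)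
    (h : Relation.ReflTransGen (stepIn R S) x y) : y ∈ S := by
  induction h with
  | refl => exact hx
  | tail _ h _ => exact h.2.1

/-- Paths from a point inside `S` stay inside the reachable set. -/
lemma connIn_reachable {α : Type*} {R : α → α → Prop} {S : Set α} (hR : ∀ x y, R x y → R y x)
    (x : α) : ConnIn R {z | Relation.ReflTransGen (stepIn R S) x z} := by
  have key : ∀ z, Relation.ReflTransGen (stepIn R S) x z →
      Relation.ReflTransGen (stepIn R {z | Relation.ReflTransGen (stepIn R S) x z}) x z := by
    intro z hz
    induction hz with
    | refl => exact .refl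
    | tail h1 h2 ih => exact ih.tail ⟨h1, h1.tail h2, h2.2.2⟩
  intro y hy z hz
  exact (stepIn.reverse hR (key y hy)).trans (key z hz)

lemma connIn_Icc (a b : Site d) : ConnIn gridAdj (Set.Icc a b) := by
  have key : ∀ (m : ℕ) (x : Site d), x ∈ Set.Icc a b → (∑ i, (x i - a i)) = m →
      Relation.ReflTransGen (stepIn gridAdj (Set.Icc a b)) x a := by
    intro m
    induction m with
    | zero =>
      intro x hx hs
      have h0 := (Finset.sum_eq_zero_iff_of_nonneg
        (fun i _ => sub_nonneg.2 (hx.1 i))).1 (by simpa using hs)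
      have : x = a := funext fun i => by simpa [sub_eq_zero] using h0 i (Finset.mem_univ i)
      rw [this]
    | succ m ih =>
      intro x hx hs
      obtain ⟨i, -, hi⟩ : ∃ i ∈ Finset.univ, 0 < x i - a i := by
        by_contra! hcon
        have := Finset.sum_nonpos hcon
        rw [hs] at this
        push_cast at this
        omega
      have hle : x - Pi.single i 1 ≤ x := by
        intro j
        by_cases hij : j = i <;> simp [hij]
      have hge : a ≤ x - Pi.single i 1 := by
        intro j
        have := hx.1 j
        by_cases hij : j = i
        · subst hij; simp; omega
        · simp [hij, this]
      have hmem : x - Pi.single i 1 ∈ Set.Icc a b := ⟨hge, hle.trans hx.2⟩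
      refine Relation.ReflTransGen.head ⟨hx, hmem, i, Or.inr (by simp)⟩ (ih _ hmem ?_)
      simp only [Pi.sub_apply, Finset.sum_sub_distrib] at hs ⊢
      simp at hs ⊢
      omega
  have key' : ∀ x ∈ Set.Icc a b, Relation.ReflTransGen (stepIn gridAdj (Set.Icc a b)) x a := by
    intro x hx
    have h0 : 0 ≤ ∑ i, (x i - a i) := Finset.sum_nonneg fun i _ => sub_nonneg.2 (hx.1 i)
    exact key (∑ i, (x i - a i)).toNat x hx (Int.toNat_of_nonneg h0).symm
  intro x hx y hy
  exact (key' x hx).trans (stepIn.reverse (fun _ _ => gridAdj.symm) (key' y hy))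

/-- Discrete Poincaré lemma: a closed `1`-cochain on a box of `ℤ^d` is exact. -/
lemma exists_potential {M : Type*} [AddCommGroup M] {a b : Site d} (h : Site d → Fin d → M)
    (hclosed : ∀ x i j, i ≠ j → x ∈ Set.Icc a b → x + Pi.single i 1 + Pi.single j 1 ∈ Set.Icc a b →
      h x i + h (x + Pi.single i 1) j = h x j + h (x + Pi.single j 1) i) :
    ∃ f : Site d → M, ∀ x i, x ∈ Set.Icc a b → x + Pi.single i 1 ∈ Set.Icc a b →
      f (x + Pi.single i 1) = f x + h x i := by
  suffices H : ∀ s : Finset (Fin d), ∃ f : Site d → M, ∀ x, ∀ i ∈ s, x ∈ Set.Icc a b →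
      x + Pi.single i 1 ∈ Set.Icc a b → f (x + Pi.single i 1) = f x + h x i by
    obtain ⟨f, hf⟩ := H Finset.univ
    exact ⟨f, fun x i => hf x i (Finset.mem_univ i)⟩
  have hpos : ∀ (x : Site d) i, x ≤ x + Pi.single i 1 := fun x i =>
    le_add_of_nonneg_right (Pi.single_nonneg.2 zero_le_one)
  intro s
  induction s using Finset.induction_on with
  | empty => exact ⟨0, by simp⟩
  | insert m s hm ih =>
    obtain ⟨f, hf⟩ := ih
    set h' : Site d → Fin d → M := fun x i => h x i - (f (x + Pi.single i 1) - f x) with hh'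
    have h'closed : ∀ x i j, i ≠ j → x ∈ Set.Icc a b →
        x + Pi.single i 1 + Pi.single j 1 ∈ Set.Icc a b →
        h' x i + h' (x + Pi.single i 1) j = h' x j + h' (x + Pi.single j 1) i := by
      intro x i j hij hx hxij
      have := hclosed x i j hij hx hxij
      simp only [hh']
      rw [add_right_comm x (Pi.single j 1)]
      have e : ∀ A B C D F G H : M, A + B = C + D →
        A - (F - H) + (B - (G - F)) = A + B - (G - H) := by intros; abel
      rw [e _ _ _ _ _ _ _ this, this]
      abel
    refine ⟨fun x => f x + ∑ t ∈ Finset.Ico (a m) (x m), h' (Function.update x m t) m, ?_⟩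
    intro x i hi hx hxi
    rcases Finset.mem_insert.1 hi with rfl | his
    · have h1 : Finset.Ico (a i) ((x + Pi.single i 1 : Site d) i) = insert (x i) (Finset.Ico (a i) (x i)) := by
        ext t
        have : a i ≤ x i := hx.1 i
        simp only [Finset.mem_Ico, Finset.mem_insert, Pi.add_apply, Pi.single_eq_same]
        omega
      have h2 : ∀ t, Function.update (x + Pi.single i 1) i t = Function.update x i t := by
        intro t
        ext j
        by_cases hj : j = i
        · subst hj; simp
        · simp [hj]
      simp only [h1, h2]
      rw [Finset.sum_insert (by simp), Function.update_eq_self]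
      simp only [hh']
      abel
    · have hne : i ≠ m := fun h => hm (h ▸ his)
      have h1 : (x + Pi.single i 1 : Site d) m = x m := by simp [hne.symm]
      beta_reduce
      rw [h1, hf x i his hx hxi]
      have h2 : ∀ t ∈ Finset.Ico (a m) (x m), h' (Function.update (x + Pi.single i 1) m t) m =
          h' (Function.update x m t) m := by
        intro t ht
        rw [Finset.mem_Ico] at ht
        set y := Function.update x m t with hy
        have e : Function.update (x + Pi.single i 1) m t = y + Pi.single i 1 := by
          ext j
          by_cases hj : j = m
          · subst hj; simp [hy, hne.symm]
          · simp [hy, hj]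
        have hyB : y ∈ Set.Icc a b := by
          constructor <;> intro j <;> by_cases hj : j = m
          · subst hj; simpa [hy] using ht.1
          · simpa [hy, hj] using hx.1 j
          · subst hj; have : x j ≤ b j := hx.2 j; simp [hy]; omega
          · simpa [hy, hj] using hx.2 j
        have hyB' : y + Pi.single i 1 + Pi.single m 1 ∈ Set.Icc a b := by
          refine ⟨hyB.1.trans ((hpos y i).trans (hpos _ m)), fun j => ?_⟩
          have := hxi.2 j
          by_cases hj : j = m
          · subst hj
            simp [hy, hne.symm] at this ⊢
            omega
          · simpa [hy, hj] using this
        have hz : ∀ w ∈ Set.Icc a b, w + Pi.single i 1 ∈ Set.Icc a b → h' w i = 0 := by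
          intro w hw hw'
          simp only [hh', hf w i his hw hw']
          abel
        have hc := h'closed y i m hne hyB hyB'
        rw [hz y hyB ⟨hyB.1.trans (hpos y i), (hpos _ m).trans hyB'.2⟩,
          hz (y + Pi.single m 1) ⟨hyB.1.trans (hpos y m), ?_⟩ ?_] at hc
        · rw [e]; simpa using hc
        · rw [add_right_comm] at hyB'
          exact (hpos _ i).trans hyB'.2
        · rw [add_right_comm] at hyB'
          exact hyB'
      rw [Finset.sum_congr rfl h2]
      abel

/-- If a set and its complement in a box are both connected, then its inner vertex boundary is
`*`-connected. -/
lemma connIn_boundary {a b : Site d} {V : Set (Site d)} (hVB : V ⊆ Set.Icc a b)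
    (hV : ConnIn gridAdj V) (hV' : ConnIn gridAdj (Set.Icc a b \ V)) :
    ConnIn starAdj {u | u ∈ V ∧ ∃ v ∈ Set.Icc a b \ V, gridAdj u v} := by
  classical
  set W := {u | u ∈ V ∧ ∃ v ∈ Set.Icc a b \ V, gridAdj u v} with hW
  intro w₀ hw₀ w hw
  set W₁ := {u | Relation.ReflTransGen (stepIn starAdj W) w₀ u} with hW₁
  have hW₁W : W₁ ⊆ W := fun u hu => stepIn.mem hw₀ hu
  have hpos : ∀ (x : Site d) i, x ≤ x + Pi.single i 1 := fun x i =>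
    le_add_of_nonneg_right (Pi.single_nonneg.2 zero_le_one)
  have hspread : ∀ p q, p ∈ W₁ → q ∈ W → starAdj p q → q ∈ W₁ := fun p q hp hq hpq =>
    Relation.ReflTransGen.tail hp ⟨hW₁W hp, hq, hpq⟩
  set h : Site d → Fin d → ZMod 2 := fun x i =>
    if (x ∈ W₁ ∧ x + Pi.single i 1 ∉ V) ∨ (x + Pi.single i 1 ∈ W₁ ∧ x ∉ V) then 1 else 0 with hh
  set c : Site d → ZMod 2 := fun x => if x ∈ V then 1 else 0 with hc
  have hedge : ∀ x i, x ∈ Set.Icc a b → x + Pi.single i 1 ∈ Set.Icc a b →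
      (x ∈ W → x ∈ W₁) → (x + Pi.single i 1 ∈ W → x + Pi.single i 1 ∈ W₁) →
      h x i = c (x + Pi.single i 1) - c x := by
    intro x i hx hxi h1 h2
    have h3 : x ∈ V → x + Pi.single i 1 ∉ V → x ∈ W₁ := fun hv hv' =>
      h1 ⟨hv, _, ⟨hxi, hv'⟩, i, Or.inl rfl⟩
    have h4 : x ∉ V → x + Pi.single i 1 ∈ V → x + Pi.single i 1 ∈ W₁ := fun hv hv' =>
      h2 ⟨hv', _, ⟨hx, hv⟩, i, Or.inr rfl⟩
    have h5 : x ∈ W₁ → x ∈ V := fun h => (hW₁W h).1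
    have h6 : x + Pi.single i 1 ∈ W₁ → x + Pi.single i 1 ∈ V := fun h => (hW₁W h).1
    simp only [hh, hc]
    by_cases hv : x ∈ V <;> by_cases hv' : x + Pi.single i 1 ∈ V
    · simp [hv, hv']
    · simp [hv, hv', h3 hv hv']
    · simp [hv, hv', h4 hv hv']
    · simp [hv, hv', mt h5 hv, mt h6 hv']
  have hclosed : ∀ x i j, i ≠ j → x ∈ Set.Icc a b →
      x + Pi.single i 1 + Pi.single j 1 ∈ Set.Icc a b →
      h x i + h (x + Pi.single i 1) j = h x j + h (x + Pi.single j 1) i := by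
    intro x i j hij hx hxij
    have hxij' : x + Pi.single j 1 + Pi.single i 1 ∈ Set.Icc a b := by rwa [add_right_comm]
    have hxi : x + Pi.single i 1 ∈ Set.Icc a b :=
      ⟨hx.1.trans (hpos x i), (hpos _ j).trans hxij.2⟩
    have hxj : x + Pi.single j 1 ∈ Set.Icc a b :=
      ⟨hx.1.trans (hpos x j), (hpos _ i).trans hxij'.2⟩
    set P : Set (Site d) := Set.Icc x (x + Pi.single i 1 + Pi.single j 1) with hP
    have hPstar : ∀ p ∈ P, ∀ q ∈ P, starAdj p q := by
      intro p hp q hq l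
      have h1 : (Pi.single i 1 + Pi.single j 1 : Site d) l ≤ 1 := by
        by_cases hl : l = i
        · subst hl; simp [hij]
        · by_cases hl' : l = j <;> simp [hl, hl', hij.symm]
      have h2 : x l ≤ p l := hp.1 l
      have h3 := hp.2 l
      have h4 : x l ≤ q l := hq.1 l
      have h5 := hq.2 l
      simp only [Pi.add_apply] at h1 h3 h5
      rw [abs_le]
      constructor <;> omega
    have m1 : x ∈ P := ⟨le_rfl, (hpos x i).trans (hpos _ j)⟩
    have m2 : x + Pi.single i 1 ∈ P := ⟨hpos x i, hpos _ j⟩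
    have m4 : x + Pi.single i 1 + Pi.single j 1 ∈ P := ⟨(hpos x i).trans (hpos _ j), le_rfl⟩
    have m4' : x + Pi.single j 1 + Pi.single i 1 ∈ P := by rwa [add_right_comm]
    have m3 : x + Pi.single j 1 ∈ P := ⟨hpos x j, (hpos _ i).trans m4'.2⟩
    by_cases hex : ∃ p ∈ P, p ∈ W₁
    · obtain ⟨p, hp, hpW⟩ := hex
      have hall : ∀ q ∈ P, q ∈ W → q ∈ W₁ := fun q hq hqW =>
        hspread p q hpW hqW (hPstar p hp q hq)
      rw [hedge x i hx hxi (hall _ m1) (hall _ m2), hedge x j hx hxj (hall _ m1) (hall _ m3),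
        hedge _ j hxi hxij (hall _ m2) (hall _ m4), hedge _ i hxj hxij' (hall _ m3) (hall _ m4'),
        add_right_comm x (Pi.single j 1)]
      abel
    · push Not at hex
      have n1 := hex x m1
      have n2 := hex _ m2
      have n3 := hex _ m3
      have n4 := hex _ m4
      have n4' := hex _ m4'
      simp only [hh, n1, n2, n3, n4, n4', false_and, or_self, if_false]
  obtain ⟨f, hf⟩ := exists_potential h hclosed
  have hsame : ∀ x y, x ∈ Set.Icc a b → y ∈ Set.Icc a b → (x ∈ V ↔ y ∈ V) → gridAdj x y →
      f x = f y := by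
    have aux : ∀ x i, x ∈ Set.Icc a b → x + Pi.single i 1 ∈ Set.Icc a b →
        (x ∈ V ↔ x + Pi.single i 1 ∈ V) → f x = f (x + Pi.single i 1) := by
      intro x i hx hxi hiff
      rw [hf x i hx hxi]
      have h5 : x ∈ W₁ → x ∈ V := fun h => (hW₁W h).1
      have h6 : x + Pi.single i 1 ∈ W₁ → x + Pi.single i 1 ∈ V := fun h => (hW₁W h).1
      have : h x i = 0 := by
        simp only [hh]
        rw [if_neg]
        tauto
      rw [this, add_zero]
    rintro x y hx hy hiff ⟨i, rfl | rfl⟩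
    · exact aux x i hx hy hiff
    · exact (aux y i hy hx hiff.symm).symm
  have hconst : ∀ S : Set (Site d), S ⊆ Set.Icc a b → (∀ x ∈ S, ∀ y ∈ S, (x ∈ V ↔ y ∈ V)) →
      ∀ x y, Relation.ReflTransGen (stepIn gridAdj S) x y → f x = f y := by
    intro S hS hSV x y hxy
    induction hxy with
    | refl => rfl
    | tail _ h ih =>
      exact ih.trans (hsame _ _ (hS h.1) (hS h.2.1) (hSV _ h.1 _ h.2.1) h.2.2)
  have hcut : ∀ u ∈ V, ∀ v ∈ Set.Icc a b \ V, gridAdj u v → (u ∈ W₁ ↔ f u ≠ f v) := by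
    rintro u hu v hv ⟨i, rfl | rfl⟩
    · rw [hf u i (hVB hu) hv.1]
      have h6 : u + Pi.single i 1 ∉ W₁ := fun h => hv.2 (hW₁W h).1
      have h7 := hv.2
      by_cases hu1 : u ∈ W₁ <;> simp [hh, hu1, h6, h7]
    · rw [hf v i hv.1 (hVB hu)]
      have h6 : v ∉ W₁ := fun h => hv.2 (hW₁W h).1
      have h7 := hv.2
      by_cases hu1 : v + Pi.single i 1 ∈ W₁ <;> simp [hh, hu1, h6, h7]
  obtain ⟨hw₀V, v₀, hv₀, hadj₀⟩ := hw₀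
  obtain ⟨hwV, v, hv, hadj⟩ := hw
  have e1 : f w₀ = f w := hconst V hVB (fun x hx y hy => by simp [hx, hy]) _ _ (hV _ hw₀V _ hwV)
  have e2 : f v₀ = f v := hconst _ Set.sdiff_subset (fun x hx y hy => by simp [hx.2, hy.2]) _ _
    (hV' _ hv₀ _ hv)
  have := (hcut w₀ hw₀V v₀ hv₀ hadj₀).1 .refl
  exact (hcut w hwV v hv hadj).2 (by rwa [← e1, ← e2])

end Connectivity

section Deterministic

variable {d : ℕ}

lemma percBox_eq_Icc (d n : ℕ) : percBox d n = Set.Icc (fun _ => 1) (fun _ => (n : ℤ)) := by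
  ext x
  simp [percBox, Set.mem_Icc, Pi.le_def, forall_and]

lemma percBox_finite (d n : ℕ) : (percBox d n).Finite := by
  rw [percBox_eq_Icc]
  exact Set.finite_Icc _ _

/-- The sites of the box joined, off `K`, to a hyperplane `{x i₀ = t}` avoiding `K`. -/
def exterior (n : ℕ) (i₀ : Fin d) (K : Finset (Site d)) : Set (Site d) :=
  {x | ∃ z ∈ percBox d n, (∀ y ∈ K, y i₀ ≠ z i₀) ∧
    Relation.ReflTransGen (stepIn gridAdj (percBox d n \ K)) x z}

/-- There is a large `*`-connected set of sites of which at least one fifth is closed. -/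
def HasBadAnimal (n k : ℕ) (ω : PConfig d) : Prop :=
  ∃ T : Finset (Site d), (T : Set (Site d)) ⊆ percBox d n ∧ ConnIn starAdj (T : Set (Site d)) ∧
    k ≤ T.card ∧ T.card ≤ 5 * (T.filter fun x => ω x = false).card

/-- The sites which are not enclosed by any `*`-connected set of closed sites. -/
def goodSites (n : ℕ) (i₀ : Fin d) (ω : PConfig d) : Set (Site d) :=
  {x | x ∈ percBox d n ∧ ∀ K : Finset (Site d), (K : Set (Site d)) ⊆ percBox d n →
    ConnIn starAdj (K : Set (Site d)) → (∀ y ∈ K, ω y = false) → x ∈ exterior n i₀ K}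

lemma card_lt_of_not_hasBadAnimal {n k : ℕ} {ω : PConfig d} (h : ¬ HasBadAnimal n k ω)
    {K : Finset (Site d)} (hK : (K : Set (Site d)) ⊆ percBox d n)
    (hconn : ConnIn starAdj (K : Set (Site d))) (hcl : ∀ y ∈ K, ω y = false) : K.card < k := by
  by_contra! hk
  refine h ⟨K, hK, hconn, hk, ?_⟩
  rw [Finset.filter_true_of_mem hcl]
  omega

lemma exists_free_coord {K : Finset (Site d)} (i : Fin d) {P : Finset ℤ}
    (hP : K.card < P.card) : ∃ t ∈ P, ∀ y ∈ K, y i ≠ t := by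
  by_contra! hcon
  have : P ⊆ K.image (· i) := fun t ht => by
    obtain ⟨y, hy, rfl⟩ := hcon t ht
    exact Finset.mem_image_of_mem _ hy
  exact absurd ((Finset.card_le_card this).trans Finset.card_image_le) (by omega)

/-- Two points of a hyperplane that avoids `K` are joined in the box off `K`. -/
lemma reach_of_free_hyperplane {n : ℕ} {i : Fin d} {K : Finset (Site d)} {x y : Site d}
    (hx : x ∈ percBox d n) (hy : y ∈ percBox d n) (hxy : x i = y i) (hfree : ∀ w ∈ K, w i ≠ x i) :
    Relation.ReflTransGen (stepIn gridAdj (percBox d n \ K)) x y := by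
  have hsub : Set.Icc (Function.update (fun _ => 1) i (x i))
      (Function.update (fun _ => (n : ℤ)) i (x i)) ⊆ percBox d n \ K := by
    intro z hz
    have hzi : z i = x i := by
      have h1 := hz.1 i
      have h2 := hz.2 i
      simp at h1 h2
      omega
    refine ⟨fun j => ?_, fun hzK => hfree z hzK hzi⟩
    by_cases hj : j = i
    · subst hj; rw [hzi]; exact hx j
    · have h1 := hz.1 j
      have h2 := hz.2 j
      simp [hj] at h1 h2
      exact ⟨h1, h2⟩
  have hmem : ∀ z ∈ percBox d n, z i = x i → z ∈ Set.Icc (Function.update (fun _ => 1) i (x i))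
      (Function.update (fun _ => (n : ℤ)) i (x i)) := by
    intro z hz hzi
    constructor <;> intro j <;> by_cases hj : j = i
    · subst hj; simp [hzi]
    · simpa [hj] using (hz j).1
    · subst hj; simp [hzi]
    · simpa [hj] using (hz j).2
  exact stepIn.mono (fun _ _ h => h) hsub
    (connIn_Icc _ _ x (hmem x hx rfl) y (hmem y hy hxy.symm))

lemma update_mem_percBox {n : ℕ} {x : Site d} (hx : x ∈ percBox d n) (i : Fin d) {t : ℤ}
    (ht : t ∈ Finset.Icc (1 : ℤ) n) : Function.update x i t ∈ percBox d n := by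
  intro j
  rw [Finset.mem_Icc] at ht
  by_cases hj : j = i
  · subst hj; simpa using ht
  · simpa [hj] using hx j

/-- A set with fewer than `n` sites has a connected exterior. -/
lemma reach_of_mem_exterior {n : ℕ} {i₀ i₁ : Fin d} (hne : i₁ ≠ i₀) {K : Finset (Site d)}
    (hK : K.card < n) {x y : Site d} (hx : x ∈ exterior n i₀ K) (hy : y ∈ exterior n i₀ K) :
    Relation.ReflTransGen (stepIn gridAdj (percBox d n \ K)) x y := by
  obtain ⟨z, hz, hzK, hxz⟩ := hx
  obtain ⟨z', hz', hzK', hyz'⟩ := hy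
  obtain ⟨t, ht, htK⟩ := exists_free_coord (K := K) i₁ (P := Finset.Icc (1 : ℤ) n)
    (by simpa using hK)
  have h1 := reach_of_free_hyperplane (y := Function.update z i₁ t) hz
    (update_mem_percBox hz i₁ ht) (by simp [hne.symm]) hzK
  have h2 := reach_of_free_hyperplane (y := Function.update z' i₁ t) hz'
    (update_mem_percBox hz' i₁ ht) (by simp [hne.symm]) hzK'
  have h3 := reach_of_free_hyperplane (i := i₁) (K := K) (update_mem_percBox hz i₁ ht)
    (update_mem_percBox hz' i₁ ht) (by simp) (by simpa using htK)
  have hs : ∀ x y : Site d, gridAdj x y → gridAdj y x := fun _ _ => gridAdj.symm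
  exact hxz.trans (h1.trans (h3.trans ((stepIn.reverse hs h2).trans (stepIn.reverse hs hyz'))))

lemma open_of_mem_goodSites {n : ℕ} {i₀ : Fin d} {ω : PConfig d} {x : Site d}
    (hx : x ∈ goodSites n i₀ ω) : ω x = true := by
  by_contra hcl
  rw [Bool.not_eq_true] at hcl
  obtain ⟨z, hz, hzK, hxz⟩ := hx.2 {x} (by simpa using hx.1)
    (by intro a ha b hb; simp at ha hb; rw [ha, hb]) (by simpa using hcl)
  rcases Relation.ReflTransGen.cases_head hxz with rfl | ⟨w, hw, -⟩
  · exact hzK x (by simp) rfl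
  · exact hw.1.2 (by simp)

/-- Without bad animals, all good sites lie in one open cluster. -/
lemma reach_of_mem_goodSites {n k : ℕ} (hkn : k ≤ n) {i₀ i₁ : Fin d} (hne : i₁ ≠ i₀)
    {ω : PConfig d} (hbad : ¬ HasBadAnimal n k ω) {x y : Site d}
    (hx : x ∈ goodSites n i₀ ω) (hy : y ∈ goodSites n i₀ ω) :
    Relation.ReflTransGen (percStep d n ω) x y := by
  have hs : ∀ x y : Site d, gridAdj x y → gridAdj y x := fun _ _ => gridAdj.symm
  set O : Set (Site d) := {z | z ∈ percBox d n ∧ ω z = true} with hO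
  set A := {z | Relation.ReflTransGen (stepIn gridAdj O) x z} with hA
  have hxO : x ∈ O := ⟨hx.1, open_of_mem_goodSites hx⟩
  have hAO : A ⊆ O := fun z hz => stepIn.mem hxO hz
  have hAconn : ConnIn gridAdj A := connIn_reachable hs x
  suffices hyA : y ∈ A from
    Relation.ReflTransGen.mono (show stepIn gridAdj O ≤ percStep d n ω from
      fun u v h => ⟨h.1.1, h.2.1.1, h.1.2, h.2.1.2, h.2.2.percAdj⟩) _ _ hyA
  by_contra hyA
  set U := {z | Relation.ReflTransGen (stepIn gridAdj (percBox d n \ A)) y z} with hU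
  have hUsub : U ⊆ percBox d n \ A := fun z hz =>
    stepIn.mem (S := percBox d n \ A) ⟨hy.1, hyA⟩ hz
  have hUconn : ConnIn gridAdj U := connIn_reachable hs y
  have hUspread : ∀ u v, u ∈ U → v ∈ percBox d n → v ∉ U → gridAdj u v → v ∈ A := by
    intro u v hu hv hvU huv
    by_contra hvA
    exact hvU (Relation.ReflTransGen.tail hu ⟨hUsub hu, ⟨hv, hvA⟩, huv⟩)
  have hAU : A ⊆ percBox d n \ U := fun z hz => ⟨(hAO hz).1, fun hzU => (hUsub hzU).2 hz⟩
  have hxA : x ∈ A := Relation.ReflTransGen.refl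
  have htoA : ∀ z, Relation.ReflTransGen (stepIn gridAdj (percBox d n)) z x → z ∉ U →
      Relation.ReflTransGen (stepIn gridAdj (percBox d n \ U)) z x := by
    intro z hz
    induction hz using Relation.ReflTransGen.head_induction_on with
    | refl => exact fun _ => .refl
    | @head z z' h1 h2 ih =>
      intro hzU
      by_cases hz'U : z' ∈ U
      · have hzA := hUspread z' z hz'U h1.1 hzU h1.2.2.symm
        exact stepIn.mono (fun _ _ h => h) hAU (hAconn z hzA x hxA)
      · exact (ih hz'U).head ⟨⟨h1.1, hzU⟩, ⟨h1.2.1, hz'U⟩, h1.2.2⟩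
  have hUcompl : ConnIn gridAdj (percBox d n \ U) := by
    have hbox : ConnIn gridAdj (percBox d n) := by
      rw [percBox_eq_Icc]; exact connIn_Icc _ _
    intro z hz w hw
    exact (htoA z (hbox z hz.1 x hx.1) hz.2).trans
      (stepIn.reverse hs (htoA w (hbox w hw.1 x hx.1) hw.2))
  set W := {u | u ∈ U ∧ ∃ v ∈ percBox d n \ U, gridAdj u v} with hW
  have hWconn : ConnIn starAdj W := by
    have hUB : U ⊆ percBox d n := fun z hz => (hUsub hz).1
    simp only [hW]
    rw [percBox_eq_Icc] at hUB hUcompl ⊢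
    exact connIn_boundary hUB hUconn hUcompl
  have hWbox : W ⊆ percBox d n := fun u hu => (hUsub hu.1).1
  have hWclosed : ∀ u ∈ W, ω u = false := by
    rintro u ⟨huU, v, hv, huv⟩
    have hvA := hUspread u v huU hv.1 hv.2 huv
    by_contra hop
    rw [Bool.not_eq_false] at hop
    exact (hUsub huU).2
      (Relation.ReflTransGen.tail hvA ⟨hAO hvA, ⟨(hUsub huU).1, hop⟩, huv.symm⟩)
  obtain ⟨K, hKW⟩ := ((percBox_finite d n).subset hWbox).exists_finset_coe
  have hKbox : (K : Set (Site d)) ⊆ percBox d n := hKW ▸ hWbox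
  have hKconn : ConnIn starAdj (K : Set (Site d)) := hKW ▸ hWconn
  have hKclosed : ∀ u ∈ K, ω u = false := fun u hu => hWclosed u (hKW ▸ Finset.mem_coe.2 hu)
  have hKcard := card_lt_of_not_hasBadAnimal hbad hKbox hKconn hKclosed
  have hreach := reach_of_mem_exterior hne (hKcard.trans_le hkn)
    (hx.2 K hKbox hKconn hKclosed) (hy.2 K hKbox hKconn hKclosed)
  have havoid : ∀ q, Relation.ReflTransGen (stepIn gridAdj (percBox d n \ K)) x q → q ∉ U := by
    intro q hq
    induction hq with
    | refl => exact (hAU hxA).2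
    | @tail p q _ h ih =>
      intro hqU
      refine h.2.1.2 ?_
      rw [hKW]
      exact ⟨hqU, p, ⟨h.1.1, ih⟩, h.2.2.symm⟩
  exact havoid y hreach .refl

/-- Without bad animals, at most a quarter of the sites of a long segment in direction `i₀` are
not good. -/
lemma card_not_good_segment {n k : ℕ} {i₀ : Fin d} {ω : PConfig d} (hbad : ¬ HasBadAnimal n k ω)
    {l : Finset (Site d)} (hl : (l : Set (Site d)) ⊆ percBox d n)
    (hconn : ConnIn gridAdj (l : Set (Site d))) (hinj : Set.InjOn (fun x : Site d => x i₀) l)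
    (hk : k ≤ l.card) [DecidablePred (· ∈ goodSites n i₀ ω)] :
    4 * (l.filter fun x => x ∉ goodSites n i₀ ω).card ≤ l.card := by
  classical
  by_contra! hcon
  set D := l.filter fun x => x ∉ goodSites n i₀ ω with hD
  have hex : ∀ x : Site d, ∃ K : Finset (Site d), x ∈ D → (K : Set (Site d)) ⊆ percBox d n ∧
      ConnIn starAdj (K : Set (Site d)) ∧ (∀ y ∈ K, ω y = false) ∧ x ∉ exterior n i₀ K := by
    intro x
    by_cases hx : x ∈ D
    · have h1 := (Finset.mem_filter.1 hx).2
      have h2 := hl (Finset.mem_filter.1 hx).1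
      by_contra! h3
      exact h1 ⟨h2, fun K hK hc ho => by by_contra h4; exact h4 ((h3 K).2 hK hc ho)⟩
    · exact ⟨∅, fun h => absurd h hx⟩
  choose K hK using hex
  have hhit : ∀ x ∈ D, ∃ y ∈ K x, y i₀ = x i₀ := by
    intro x hx
    by_contra! hno
    exact (hK x hx).2.2.2 ⟨x, hl (Finset.mem_filter.1 hx).1, hno, .refl⟩
  have hmeet : ∀ x ∈ D, ∃ y ∈ K x, y ∈ l := by
    intro x hx
    obtain ⟨hKb, hKc, hKo, hKx⟩ := hK x hx
    by_contra! hno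
    have hcard := card_lt_of_not_hasBadAnimal hbad hKb hKc hKo
    obtain ⟨t, ht, htK⟩ := exists_free_coord (K := K x) i₀
      (P := l.image fun x : Site d => x i₀) (by
        rw [Finset.card_image_of_injOn hinj]; omega)
    obtain ⟨z, hz, rfl⟩ := Finset.mem_image.1 ht
    refine hKx ⟨z, hl hz, htK, ?_⟩
    have hsub : (l : Set (Site d)) ⊆ percBox d n \ K x := fun w hw =>
      ⟨hl hw, fun hwK => hno w hwK hw⟩
    exact stepIn.mono (fun _ _ h => h) hsub (hconn x (Finset.mem_filter.1 hx).1 z hz)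
  set S := D.biUnion K with hS
  have hSclosed : ∀ y ∈ S, ω y = false := by
    intro y hy
    obtain ⟨x, hx, hyx⟩ := Finset.mem_biUnion.1 hy
    exact (hK x hx).2.2.1 y hyx
  have hDS : D.card ≤ S.card := by
    have h1 : D.image (fun x : Site d => x i₀) ⊆ S.image (fun x : Site d => x i₀) := by
      intro t ht
      obtain ⟨x, hx, rfl⟩ := Finset.mem_image.1 ht
      obtain ⟨y, hy, hyx⟩ := hhit x hx
      exact Finset.mem_image.2 ⟨y, Finset.mem_biUnion.2 ⟨x, hx, hy⟩, hyx⟩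
    rw [← Finset.card_image_of_injOn (hinj.mono (Finset.coe_subset.2 (Finset.filter_subset _ l)))]
    exact (Finset.card_le_card h1).trans Finset.card_image_le
  have hs : ∀ x y : Site d, starAdj x y → starAdj y x := fun _ _ => starAdj.symm
  refine hbad ⟨l ∪ S, ?_, ?_, hk.trans (Finset.card_le_card Finset.subset_union_left), ?_⟩
  · intro y hy
    rcases Finset.mem_union.1 (Finset.mem_coe.1 hy) with hy | hy
    · exact hl hy
    · obtain ⟨x, hx, hyx⟩ := Finset.mem_biUnion.1 hy
      exact (hK x hx).1 hyx
  · have hlT : ConnIn starAdj (l : Set (Site d)) := fun x hx y hy =>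
      stepIn.mono (fun _ _ => gridAdj.starAdj) subset_rfl (hconn x hx y hy)
    have htol : ∀ y ∈ l ∪ S, ∃ z ∈ l,
        Relation.ReflTransGen (stepIn starAdj ((l ∪ S : Finset (Site d)) : Set (Site d))) y z := by
      intro y hy
      rcases Finset.mem_union.1 hy with hy | hy
      · exact ⟨y, hy, .refl⟩
      · obtain ⟨x, hx, hyx⟩ := Finset.mem_biUnion.1 hy
        obtain ⟨z, hzK, hzl⟩ := hmeet x hx
        refine ⟨z, hzl, stepIn.mono (fun _ _ h => h) ?_ ((hK x hx).2.1 y hyx z hzK)⟩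
        exact Finset.coe_subset.2
          ((Finset.subset_biUnion_of_mem K hx).trans Finset.subset_union_right)
    intro x hx y hy
    obtain ⟨z, hz, hxz⟩ := htol x hx
    obtain ⟨w, hw, hyw⟩ := htol y hy
    exact hxz.trans ((stepIn.mono (fun _ _ h => h)
      (Finset.coe_subset.2 Finset.subset_union_left) (hlT z hz w hw)).trans
        (stepIn.reverse hs hyw))
  · have h1 : S ⊆ (l ∪ S).filter fun x => ω x = false := fun y hy =>
      Finset.mem_filter.2 ⟨Finset.mem_union_right _ hy, hSclosed y hy⟩
    have h2 := Finset.card_le_card h1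
    have h3 := Finset.card_union_le l S
    omega

/-- Without bad animals, at most a quarter of the sites of a large cube are not good. -/
lemma card_not_good_cube {n k : ℕ} {i₀ : Fin d} {ω : PConfig d} (hbad : ¬ HasBadAnimal n k ω)
    {L : ℕ} (hk : k ≤ L) (u : Site d)
    (hu : Set.Icc (u + 1) (u + fun _ => (L : ℤ)) ⊆ percBox d n)
    [DecidablePred (· ∈ goodSites n i₀ ω)] :
    4 * ((Finset.Icc (u + 1) (u + fun _ => (L : ℤ))).filter
      fun x => x ∉ goodSites n i₀ ω).card ≤ L ^ d := by
  classical
  set Q := Finset.Icc (u + 1) (u + fun _ => (L : ℤ)) with hQ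
  have hQcard : Q.card = L ^ d := by
    simp [hQ, Pi.card_Icc]
  set f : Site d → Site d := fun x => Function.update x i₀ (u i₀ + 1) with hf
  have hQm : ∀ x ∈ Q, f x ∈ Q.image f := fun x hx => Finset.mem_image_of_mem f hx
  rw [← hQcard, Finset.card_eq_sum_card_fiberwise (f := f) (t := Q.image f) hQm,
    Finset.card_eq_sum_card_fiberwise (f := f) (t := Q.image f)
      (fun x hx => hQm x (Finset.mem_filter.1 hx).1), Finset.mul_sum]
  refine Finset.sum_le_sum fun b hb => ?_
  obtain ⟨a, ha, rfl⟩ := Finset.mem_image.1 hb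
  rw [Finset.filter_filter]
  simp_rw [and_comm (b := f _ = f a)]
  rw [← Finset.filter_filter]
  have hseg : (Q.filter fun x => f x = f a) =
      Finset.Icc (Function.update a i₀ (u i₀ + 1)) (Function.update a i₀ (u i₀ + L)) := by
    rw [hQ, Finset.mem_Icc] at ha
    ext x
    simp only [Finset.mem_filter, hQ, Finset.mem_Icc, hf]
    constructor
    · rintro ⟨⟨h1, h2⟩, h3⟩
      have h4 : ∀ j, j ≠ i₀ → x j = a j := fun j hj => by
        have := congrFun h3 j
        simpa [hj] using this
      constructor <;> intro j <;> by_cases hj : j = i₀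
      · subst hj; simpa using h1 j
      · simp [hj, h4 j hj]
      · subst hj; simpa using h2 j
      · simp [hj, h4 j hj]
    · rintro ⟨h1, h2⟩
      have h4 : ∀ j, j ≠ i₀ → x j = a j := fun j hj => by
        have h5 := h1 j
        have h6 := h2 j
        simp [hj] at h5 h6
        omega
      refine ⟨⟨fun j => ?_, fun j => ?_⟩, ?_⟩
      · by_cases hj : j = i₀
        · subst hj; simpa using h1 j
        · rw [h4 j hj]; exact ha.1 j
      · by_cases hj : j = i₀
        · subst hj; simpa using h2 j
        · rw [h4 j hj]; exact ha.2 j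
      · ext j
        by_cases hj : j = i₀
        · subst hj; simp
        · simp [hj, h4 j hj]
  have hcard : (Q.filter fun x => f x = f a).card = L := by
    rw [hseg, Pi.card_Icc, Finset.prod_eq_single i₀]
    · simp
    · intro j _ hj; simp [hj]
    · simp
  refine card_not_good_segment hbad ?_ ?_ ?_ (hk.trans hcard.ge)
  · intro x hx
    exact hu (Finset.mem_Icc.1 (Finset.mem_filter.1 hx).1)
  · rw [hseg, Finset.coe_Icc]
    exact connIn_Icc _ _
  · intro x hx y hy hxy
    have h3 := ((Finset.mem_filter.1 hx).2).trans ((Finset.mem_filter.1 hy).2).symm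
    ext j
    by_cases hj : j = i₀
    · subst hj; exact hxy
    · simpa [hf, hj] using congrFun h3 j

/-- Without bad animals, every maximal cluster contains all good sites. -/
lemma goodSites_subset_of_isMaxCluster {n k : ℕ} (hn : 0 < n) (hkn : k ≤ n) {i₀ i₁ : Fin d}
    (hne : i₁ ≠ i₀) {ω : PConfig d} (hbad : ¬ HasBadAnimal n k ω) {M : Set (Site d)}
    (hM : IsMaxCluster d n ω M) : goodSites n i₀ ω ⊆ M := by
  classical
  set Q := Finset.Icc ((0 : Site d) + 1) (0 + fun _ => (n : ℤ)) with hQ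
  have hQbox : (Q : Set (Site d)) = percBox d n := by
    rw [percBox_eq_Icc, hQ, Finset.coe_Icc, zero_add, zero_add]; rfl
  have hQcard : Q.card = n ^ d := by simp [hQ, Pi.card_Icc]
  have hQn : 0 < Q.card := by rw [hQcard]; positivity
  have hnot : 4 * (Q.filter fun x => x ∉ goodSites n i₀ ω).card ≤ Q.card := by
    rw [hQcard]
    refine card_not_good_cube hbad hkn 0 ?_
    rw [← Finset.coe_Icc, ← hQ, hQbox]
  have hsplit := Finset.card_filter_add_card_filter_not (s := Q) (fun x => x ∈ goodSites n i₀ ω)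
  obtain ⟨g, hg⟩ : (Q.filter fun x => x ∈ goodSites n i₀ ω).Nonempty := by
    rw [← Finset.card_pos]; omega
  have hg := (Finset.mem_filter.1 hg).2
  set A := {z | Relation.ReflTransGen (percStep d n ω) g z} with hA
  have hAcl : IsCluster d n ω A := by
    have hsymm : ∀ z, Relation.ReflTransGen (percStep d n ω) g z →
        Relation.ReflTransGen (percStep d n ω) z g := by
      intro z hz
      induction hz with
      | refl => exact .refl
      | tail _ h ih =>
        refine ih.head ⟨h.2.1, h.1, h.2.2.2.1, h.2.2.1, ?_⟩
        have := h.2.2.2.2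
        unfold percAdj at this ⊢
        rw [← this]
        exact Finset.sum_congr rfl fun i _ => by ring
    refine ⟨⟨g, .refl⟩, fun x hx => ?_, fun x hx y hy => (hsymm x hx).trans hy,
      fun x hx y h => Relation.ReflTransGen.tail hx h⟩
    rcases Relation.ReflTransGen.cases_tail hx with rfl | ⟨w, -, hw⟩
    · exact ⟨hg.1, open_of_mem_goodSites hg⟩
    · exact ⟨hw.2.1, hw.2.2.2.1⟩
  have hGA : goodSites n i₀ ω ⊆ A := fun x hx => reach_of_mem_goodSites hkn hne hbad hg hx
  have hMQ : M ⊆ Q := fun x hx => hQbox ▸ (hM.1.2.1 x hx).1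
  have hAQ : A ⊆ Q := fun x hx => hQbox ▸ (hAcl.2.1 x hx).1
  have hMcard : (Q.filter fun x => x ∈ goodSites n i₀ ω).card ≤ M.ncard := by
    refine le_trans ?_ (hM.2 A hAcl)
    rw [← Set.ncard_coe_finset]
    exact Set.ncard_le_ncard (fun x hx => hGA (Finset.mem_filter.1 hx).2)
      (Q.finite_toSet.subset hAQ)
  obtain ⟨m, hmM, hmG⟩ : ∃ m ∈ M, m ∈ goodSites n i₀ ω := by
    by_contra! hcon
    have : M.ncard ≤ (Q.filter fun x => x ∉ goodSites n i₀ ω).card := by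
      rw [← Set.ncard_coe_finset]
      exact Set.ncard_le_ncard (fun x hx => Finset.mem_coe.2
        (Finset.mem_filter.2 ⟨hMQ hx, hcon x hx⟩)) (Finset.finite_toSet _)
    omega
  intro x hx
  have hstay : ∀ z, Relation.ReflTransGen (percStep d n ω) m z → z ∈ M := by
    intro z hz
    induction hz with
    | refl => exact hmM
    | tail _ h ih => exact hM.1.2.2.2 _ ih _ h
  exact hstay x (reach_of_mem_goodSites hkn hne hbad hmG hx)

/-- Without bad animals, every maximal cluster has density at least `3 / 4` in every large cube. -/
lemma isMaxCluster_density {n k : ℕ} (hn : 0 < n) (hkn : k ≤ n) {i₀ i₁ : Fin d}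
    (hne : i₁ ≠ i₀) {ω : PConfig d} (hbad : ¬ HasBadAnimal n k ω) {M : Set (Site d)}
    (hM : IsMaxCluster d n ω M) {u : Site d}
    (hu : Set.Icc (u + 1) (u + fun _ => (k : ℤ)) ⊆ percBox d n) :
    3 / 4 * (k : ℝ) ^ d ≤ ((M ∩ Set.Icc (u + 1) (u + fun _ => (k : ℤ))).ncard : ℝ) := by
  classical
  set Q := Finset.Icc (u + 1) (u + fun _ => (k : ℤ)) with hQ
  have hQcard : Q.card = k ^ d := by simp [hQ, Pi.card_Icc]
  have hnot : 4 * (Q.filter fun x => x ∉ goodSites n i₀ ω).card ≤ k ^ d :=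
    card_not_good_cube hbad le_rfl u hu
  have hsplit := Finset.card_filter_add_card_filter_not (s := Q) (fun x => x ∈ goodSites n i₀ ω)
  have hle : (Q.filter fun x => x ∈ goodSites n i₀ ω).card ≤
      (M ∩ Set.Icc (u + 1) (u + fun _ => (k : ℤ))).ncard := by
    rw [← Set.ncard_coe_finset]
    refine Set.ncard_le_ncard (fun x hx => ?_) ((Set.finite_Icc _ _).inter_of_right _)
    rw [Finset.mem_coe, Finset.mem_filter] at hx
    exact ⟨goodSites_subset_of_isMaxCluster hn hkn hne hbad hM hx.2, Finset.mem_Icc.1 hx.1⟩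
  have : 3 * k ^ d ≤ 4 * (M ∩ Set.Icc (u + 1) (u + fun _ => (k : ℤ))).ncard := by omega
  have : (3 : ℝ) * (k : ℝ) ^ d ≤ 4 * ((M ∩ Set.Icc (u + 1) (u + fun _ => (k : ℤ))).ncard : ℝ) := by
    exact_mod_cast this
  linarith

end Deterministic

section Counting

variable {d : ℕ}

/-- The `*`-walks with `m` steps started at `x`. -/
def starWalks : ℕ → Site d → Finset (List (Site d))
  | 0, x => {[x]}
  | m + 1, x => (Finset.Icc (x - 1) (x + 1)).biUnion fun y => (starWalks m y).image (x :: ·)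

lemma card_starWalks_le (m : ℕ) (x : Site d) : (starWalks m x).card ≤ (3 ^ d) ^ m := by
  induction m generalizing x with
  | zero => simp [starWalks]
  | succ m ih =>
    have h3 : (Finset.Icc (x - 1) (x + 1)).card = 3 ^ d := by
      have : ∀ i, x i + 1 + 1 - (x i - 1) = 3 := fun i => by ring
      simp [Pi.card_Icc, this]
    rw [starWalks, pow_succ', ← h3]
    refine Finset.card_biUnion_le_card_mul _ _ _ fun y _ => ?_
    rw [h3]
    exact Finset.card_image_le.trans (ih y)

lemma mem_starWalks {w : List (Site d)} {m : ℕ} {x : Site d} (hx : w.head? = some x)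
    (hw : w.IsChain starAdj) (hm : w.length = m + 1) : w ∈ starWalks m x := by
  induction m generalizing w x with
  | zero =>
    obtain ⟨y, rfl⟩ := List.length_eq_one_iff.1 hm
    simp at hx
    simp [starWalks, hx]
  | succ m ih =>
    match w, hm with
    | y :: z :: w, hm =>
      obtain rfl : y = x := by simpa using hx
      rw [List.isChain_cons_cons] at hw
      rw [starWalks, Finset.mem_biUnion]
      refine ⟨z, ?_, Finset.mem_image_of_mem _ (ih (by simp) hw.2 (by simpa using hm))⟩
      rw [Finset.mem_Icc]
      constructor <;> intro i <;> have := abs_le.1 (hw.1 i) <;> simp <;> omega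

lemma exists_crossing_step {α : Type*} {r : α → α → Prop} {S : Set α} {x y : α}
    (h : Relation.ReflTransGen r x y) (hx : x ∈ S) (hy : y ∉ S) : ∃ s ∈ S, ∃ t ∉ S, r s t := by
  induction h with
  | refl => exact absurd hx hy
  | @tail b c _ h ih =>
    by_cases hb : b ∈ S
    · exact ⟨b, hb, c, hy, h⟩
    · exact ih hb

/-- A `*`-connected set with `m + 1` sites is the range of a `*`-walk with `2 * m` steps. -/
lemma exists_walk_of_connIn {T : Finset (Site d)} (hT : ConnIn starAdj (T : Set (Site d)))
    {x : Site d} (hx : x ∈ T) {m : ℕ} (hm : T.card = m + 1) :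
    ∃ w ∈ starWalks (2 * m) x, w.toFinset = T := by
  suffices H : ∀ l, l + 1 ≤ T.card → ∃ w : List (Site d), w.head? = some x ∧ w.IsChain starAdj ∧
      w.length = 2 * l + 1 ∧ w.toFinset ⊆ T ∧ w.toFinset.card = l + 1 by
    obtain ⟨w, h1, h2, h3, h4, h5⟩ := H m hm.ge
    exact ⟨w, mem_starWalks h1 h2 h3, Finset.eq_of_subset_of_card_le h4 (by omega)⟩
  intro l
  induction l with
  | zero => exact fun _ => ⟨[x], by simpa using hx⟩
  | succ l ih =>
    intro hl
    obtain ⟨w, h1, h2, h3, h4, h5⟩ := ih (by omega)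
    obtain ⟨y, hyT, hyw⟩ := Finset.exists_mem_notMem_of_card_lt_card
      (show w.toFinset.card < T.card by omega)
    have hxw : x ∈ w := List.mem_of_mem_head? h1
    obtain ⟨s, hs, t, ht, hsT, htT, hst⟩ := exists_crossing_step (S := (w.toFinset : Set (Site d)))
      (hT x hx y hyT) (by simpa using hxw) (by simpa using hyw)
    have hs' : s ∈ w := by simpa using hs
    obtain ⟨w₁, w₂, rfl⟩ := List.append_of_mem hs'
    have hset : (w₁ ++ s :: t :: s :: w₂).toFinset = insert t (w₁ ++ s :: w₂).toFinset := by
      ext z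
      simp
    refine ⟨w₁ ++ s :: t :: s :: w₂, ?_, ?_, ?_, ?_, ?_⟩
    · cases w₁ <;> simpa using h1
    · rw [List.isChain_split] at h2 ⊢
      exact ⟨h2.1, by simp [List.isChain_cons_cons, hst, hst.symm, h2.2]⟩
    · simp at h3 ⊢
      omega
    · rw [hset]
      exact Finset.insert_subset htT h4
    · rw [hset, Finset.card_insert_of_notMem (by simpa using ht), h5]

end Counting

section Probability

variable {d : ℕ} {p : ℝ} {μ : Measure (PConfig d)} {r : ℝ≥0∞}

lemma measure_fifth_closed_le (hμ : IsBernoulliPerc d p μ) (hr : ENNReal.ofReal (1 - p) ≤ r ^ 5)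
    (hr1 : r ≤ 1) (T : Finset (Site d)) :
    μ {ω | T.card ≤ 5 * (T.filter fun x => ω x = false).card} ≤ (2 * r) ^ T.card := by
  have hsub : {ω : PConfig d | T.card ≤ 5 * (T.filter fun x => ω x = false).card} ⊆
      ⋃ S ∈ T.powerset.filter (fun S => T.card ≤ 5 * S.card), {ω | ∀ x ∈ S, ω x = false} := by
    intro ω hω
    simp only [Set.mem_iUnion]
    exact ⟨T.filter fun x => ω x = false, Finset.mem_filter.2
      ⟨Finset.mem_powerset.2 (Finset.filter_subset _ _), hω⟩, fun x hx => (Finset.mem_filter.1 hx).2⟩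
  calc μ {ω | T.card ≤ 5 * (T.filter fun x => ω x = false).card}
      ≤ ∑ S ∈ T.powerset.filter (fun S => T.card ≤ 5 * S.card), μ {ω | ∀ x ∈ S, ω x = false} :=
        (measure_mono hsub).trans (measure_biUnion_finset_le _ _)
    _ ≤ ∑ S ∈ T.powerset.filter (fun S => T.card ≤ 5 * S.card), r ^ T.card := by
        refine Finset.sum_le_sum fun S hS => ?_
        rw [hμ.2 S fun _ => false]
        simp only [Bool.false_eq_true, if_false, Finset.prod_const]
        calc ENNReal.ofReal (1 - p) ^ S.card ≤ (r ^ 5) ^ S.card := by gcongr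
          _ = r ^ (5 * S.card) := (pow_mul _ _ _).symm
          _ ≤ r ^ T.card := pow_le_pow_right_of_le_one' hr1 (Finset.mem_filter.1 hS).2
    _ ≤ ∑ S ∈ T.powerset, r ^ T.card :=
        Finset.sum_le_sum_of_subset (Finset.filter_subset _ _)
    _ = (2 * r) ^ T.card := by
        rw [Finset.sum_const, Finset.card_powerset, nsmul_eq_mul, mul_pow]
        push_cast
        rfl

lemma measure_hasBadAnimal_le (hμ : IsBernoulliPerc d p μ) (hr : ENNReal.ofReal (1 - p) ≤ r ^ 5)
    (hr9 : 9 ^ d * (2 * r) ≤ 3⁻¹) {n k : ℕ} (hk : 0 < k) :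
    μ {ω | HasBadAnimal n k ω} ≤ (n : ℝ≥0∞) ^ (2 * d) * 3⁻¹ ^ k := by
  have hr1 : r ≤ 1 := by
    calc r = 1 * (1 * r) := by simp
      _ ≤ 9 ^ d * (2 * r) := by
        gcongr
        · exact one_le_pow₀ (by norm_num)
        · norm_num
      _ ≤ 3⁻¹ := hr9
      _ ≤ 1 := by simp
  set Q := Finset.Icc (fun _ => 1 : Site d) (fun _ => (n : ℤ)) with hQ
  have hQbox : (Q : Set (Site d)) = percBox d n := by rw [percBox_eq_Icc, hQ, Finset.coe_Icc]
  have hQcard : Q.card = n ^ d := by simp [hQ, Pi.card_Icc]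
  set F : Site d → ℕ → Finset (List (Site d)) := fun x N =>
    (starWalks (2 * (N - 1)) x).filter fun w => w.toFinset.card = N with hF
  set E : List (Site d) → Set (PConfig d) := fun w =>
    {ω | w.toFinset.card ≤ 5 * (w.toFinset.filter fun x => ω x = false).card} with hE
  have hsub : {ω : PConfig d | HasBadAnimal n k ω} ⊆
      ⋃ x ∈ Q, ⋃ N ∈ Finset.Icc k (n ^ d), ⋃ w ∈ F x N, E w := by
    rintro ω ⟨T, hTbox, hTconn, hkT, hT⟩
    rw [← hQbox, Finset.coe_subset] at hTbox
    obtain ⟨x, hx⟩ : T.Nonempty := Finset.card_pos.1 (by omega)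
    obtain ⟨w, hw, rfl⟩ := exists_walk_of_connIn hTconn hx (m := T.card - 1) (by omega)
    simp only [Set.mem_iUnion]
    exact ⟨x, hTbox hx, w.toFinset.card, Finset.mem_Icc.2
      ⟨hkT, hQcard ▸ Finset.card_le_card hTbox⟩, w, Finset.mem_filter.2 ⟨hw, rfl⟩, hT⟩
  have hN : ∀ x, ∀ N ∈ Finset.Icc k (n ^ d), μ (⋃ w ∈ F x N, E w) ≤ 3⁻¹ ^ k := by
    intro x N hN
    have hkN := (Finset.mem_Icc.1 hN).1
    calc μ (⋃ w ∈ F x N, E w) ≤ ∑ w ∈ F x N, μ (E w) := measure_biUnion_finset_le _ _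
      _ ≤ ∑ w ∈ F x N, (2 * r) ^ N := by
        refine Finset.sum_le_sum fun w hw => ?_
        have := measure_fifth_closed_le hμ hr hr1 w.toFinset
        calc μ (E w) ≤ (2 * r) ^ w.toFinset.card := this
          _ = (2 * r) ^ N := by rw [(Finset.mem_filter.1 hw).2]
      _ = (F x N).card * (2 * r) ^ N := by rw [Finset.sum_const, nsmul_eq_mul]
      _ ≤ (9 ^ d) ^ N * (2 * r) ^ N := by
        gcongr
        have h1 : (F x N).card ≤ (9 ^ d) ^ N := by
          calc (F x N).card ≤ (3 ^ d) ^ (2 * (N - 1)) :=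
                (Finset.card_filter_le _ _).trans (card_starWalks_le _ _)
            _ ≤ (3 ^ d) ^ (2 * N) := Nat.pow_le_pow_right (by positivity) (by omega)
            _ = (9 ^ d) ^ N := by rw [pow_mul, ← pow_mul 3 d 2, mul_comm d 2, pow_mul 3 2 d]; norm_num
        exact_mod_cast h1
      _ = (9 ^ d * (2 * r)) ^ N := (mul_pow _ _ _).symm
      _ ≤ 3⁻¹ ^ N := by gcongr
      _ ≤ 3⁻¹ ^ k := pow_le_pow_right_of_le_one' (by simp) hkN
  calc μ {ω | HasBadAnimal n k ω}
      ≤ ∑ x ∈ Q, ∑ N ∈ Finset.Icc k (n ^ d), μ (⋃ w ∈ F x N, E w) :=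
        (measure_mono hsub).trans ((measure_biUnion_finset_le _ _).trans
          (Finset.sum_le_sum fun x _ => measure_biUnion_finset_le _ _))
    _ ≤ ∑ x ∈ Q, ∑ N ∈ Finset.Icc k (n ^ d), 3⁻¹ ^ k :=
        Finset.sum_le_sum fun x _ => Finset.sum_le_sum (hN x)
    _ = (n : ℝ≥0∞) ^ d * ((Finset.Icc k (n ^ d)).card * 3⁻¹ ^ k) := by
        simp only [Finset.sum_const, nsmul_eq_mul, hQcard]
        push_cast
        rfl
    _ ≤ (n : ℝ≥0∞) ^ d * ((n : ℝ≥0∞) ^ d * 3⁻¹ ^ k) := by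
        gcongr
        have : (Finset.Icc k (n ^ d)).card ≤ n ^ d := by rw [Nat.card_Icc]; omega
        exact_mod_cast this
    _ = (n : ℝ≥0∞) ^ (2 * d) * 3⁻¹ ^ k := by rw [← mul_assoc, ← pow_add, two_mul]

lemma pow_mul_inv_three_pow_le {c : ℝ} (hc : 2 * d + 2 ≤ c) {n k : ℕ} (hn : 2 ≤ n)
    (hk : c * Real.log n ≤ k) : (n : ℝ) ^ (2 * d) * 3⁻¹ ^ k ≤ 1 / (n : ℝ) ^ 2 := by
  have hn0 : (0 : ℝ) < n := by positivity
  have hlog : 0 ≤ Real.log n := Real.log_natCast_nonneg n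
  have h1 : (n : ℝ) ^ (2 * d + 2) ≤ 3 ^ k := by
    calc (n : ℝ) ^ (2 * d + 2) = Real.exp ((2 * d + 2 : ℕ) * Real.log n) := by
          rw [Real.exp_nat_mul, Real.exp_log hn0]
      _ ≤ Real.exp (k * 1) := by
          apply Real.exp_le_exp.2
          push_cast
          nlinarith
      _ = Real.exp 1 ^ k := Real.exp_nat_mul _ _
      _ ≤ 3 ^ k := by
          have := Real.exp_one_lt_d9
          gcongr
          linarith
  rw [inv_pow, ← div_eq_mul_inv, div_le_div_iff₀ (by positivity) (by positivity), one_mul, ← pow_add]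
  exact h1

lemma ae_eventually_not_hasBadAnimal (hμ : IsBernoulliPerc d p μ)
    (hr : ENNReal.ofReal (1 - p) ≤ r ^ 5) (hr9 : 9 ^ d * (2 * r) ≤ 3⁻¹) {c : ℝ}
    (hc : 2 * d + 2 ≤ c) :
    ∀ᵐ ω ∂μ, ∀ᶠ n : ℕ in atTop, ¬ HasBadAnimal n ⌈c * Real.log n⌉₊ ω := by
  have hle : ∀ n : ℕ, μ {ω | 2 ≤ n ∧ HasBadAnimal n ⌈c * Real.log n⌉₊ ω} ≤
      ENNReal.ofReal (1 / (n : ℝ) ^ 2) := by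
    intro n
    by_cases hn : 2 ≤ n
    · have hc0 : 0 < c := by
        have : (0 : ℝ) ≤ d := Nat.cast_nonneg d
        linarith
      have hlog : 0 < Real.log n := Real.log_pos (by exact_mod_cast hn)
      have hk : 0 < ⌈c * Real.log n⌉₊ := Nat.ceil_pos.2 (by positivity)
      simp only [hn, true_and]
      refine (measure_hasBadAnimal_le hμ hr hr9 hk).trans ?_
      refine le_trans (le_of_eq ?_)
        (ENNReal.ofReal_le_ofReal (pow_mul_inv_three_pow_le hc hn (Nat.le_ceil _)))
      rw [ENNReal.ofReal_mul (by positivity), ENNReal.ofReal_pow (by positivity),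
        ENNReal.ofReal_pow (by positivity), ENNReal.ofReal_inv_of_pos (by norm_num)]
      simp
    · simp [hn]
  have hsum : ∑' n : ℕ, μ {ω | 2 ≤ n ∧ HasBadAnimal n ⌈c * Real.log n⌉₊ ω} ≠ ∞ := by
    refine ne_top_of_le_ne_top ?_ (ENNReal.tsum_le_tsum hle)
    exact (Real.summable_one_div_nat_pow.2 one_lt_two).tsum_ofReal_ne_top
  filter_upwards [ae_eventually_notMem hsum] with ω hω
  filter_upwards [hω, eventually_ge_atTop 2] with n hn h2 hbad
  exact hn ⟨h2, hbad⟩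

end Probability

/-- Proposition B.2: density of the maximal cluster in all cubes of side `c₁ log n`. -/
theorem stmt_15 {d : ℕ} (hd : 2 ≤ d) :
    ∃ p₀ : ℝ, p₀ < 1 ∧ ∀ p : ℝ, p₀ ≤ p → p < 1 →
      ∃ κ c' : ℝ, 0 < κ ∧ 0 < c' ∧ ∀ c₁ : ℝ, c' ≤ c₁ →
        ∀ μ : Measure (PConfig d), IsBernoulliPerc d p μ →
          ∀ᵐ ω ∂μ, ∀ᶠ n : ℕ in atTop,
            ∀ k : ℕ, (k : ℝ) = c₁ * Real.log n → k ∣ n →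
              ∀ M : Set (Site d), IsMaxCluster d n ω M →
                ∀ j : Fin d → ℕ, (∀ i, j i < n / k) →
                  κ * (k : ℝ) ^ d ≤
                    (((M ∩ {x : Site d | ∀ i,
                      (j i * k : ℤ) < x i ∧ x i ≤ ((j i + 1) * k : ℤ)}).ncard : ℝ)) := by
  set r : ℝ := (6 * 9 ^ d)⁻¹ with hr
  have hr0 : 0 < r := by positivity
  refine ⟨1 - r ^ 5, by linarith [pow_pos hr0 5], fun p hp _ => ?_⟩
  refine ⟨3 / 4, 2 * d + 2, by norm_num, by positivity, fun c₁ hc μ hμ => ?_⟩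
  have h1 : ENNReal.ofReal (1 - p) ≤ ENNReal.ofReal r ^ 5 := by
    rw [← ENNReal.ofReal_pow hr0.le]
    exact ENNReal.ofReal_le_ofReal (by linarith)
  have h2 : 9 ^ d * (2 * ENNReal.ofReal r) ≤ 3⁻¹ := by
    refine le_of_eq ?_
    have e : (9 : ℝ) ^ d * (2 * r) = 3⁻¹ := by
      rw [hr]
      field_simp
      norm_num
    calc (9 : ℝ≥0∞) ^ d * (2 * ENNReal.ofReal r) = ENNReal.ofReal (9 ^ d * (2 * r)) := by
          rw [ENNReal.ofReal_mul (by positivity), ENNReal.ofReal_mul (by norm_num),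
            ENNReal.ofReal_pow (by norm_num)]
          simp
      _ = 3⁻¹ := by
          rw [e, ENNReal.ofReal_inv_of_pos (by norm_num)]
          simp
  filter_upwards [ae_eventually_not_hasBadAnimal hμ h1 h2 hc] with ω hω
  filter_upwards [hω, eventually_ge_atTop 2] with n hbad hn k hk hkn M hM j hj
  rw [← hk, Nat.ceil_natCast] at hbad
  have hne : (⟨1, by omega⟩ : Fin d) ≠ ⟨0, by omega⟩ := by simp
  set u : Site d := fun i => j i * k with hu
  have hset : {x : Site d | ∀ i, (j i * k : ℤ) < x i ∧ x i ≤ ((j i + 1) * k : ℤ)} =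
      Set.Icc (u + 1) (u + fun _ => (k : ℤ)) := by
    ext x
    simp only [Set.mem_ofPred_eq, Set.mem_Icc, Pi.le_def, hu, Pi.add_apply, Pi.one_apply,
      Int.add_one_le_iff, add_mul, one_mul, forall_and]
  rw [hset]
  refine isMaxCluster_density (by omega) (Nat.le_of_dvd (by omega) hkn) hne hbad hM ?_
  rw [← hset]
  intro x hx i
  obtain ⟨hx1, hx2⟩ := hx i
  have h3 : (j i + 1) * k ≤ n :=
    (Nat.mul_le_mul_right k (hj i)).trans (Nat.div_mul_le_self n k)
  have h4 : ((j i : ℤ) + 1) * k ≤ n := by exact_mod_cast h3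
  have h5 : (0 : ℤ) ≤ j i * k := by positivity
  exact ⟨by omega, hx2.trans h4⟩

end
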